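/- For every real k, every 0 < p ≤ 1 with q = 1 − p, every complex z with |z| < 1, and all m, n ∈ {1,2}, one has P̂_{m,n}(k,z) = δ_{m,n} + (q/p)·Q̂_{m,n}(k,z) + Σ_{l∈{1,2}} P̂_{m,l}(k,z)·Q̂_{l,n}(k,z); equivalently, in matrix form, P = I + (q/p)Q + PQ. -/

import Mathlib

noncomputable section

open Complex Filter

/-- Amplitude functions on the position × coin space `ℤ × {1,2}`
(coin `0` = "right", coin `1` = "left"). -/
abbrev QState := ℤ × Fin 2 → ℂ

/-- One step of the Hadamard walk: `(hadamardStep ψ) (x,n) = ⟨x,n|U ψ⟩`, where `U = S ∘ C`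
with `S` the chirality-conditioned shift and `C` the Hadamard coin. -/
def hadamardStep (ψ : QState) : QState := fun v =>
  if v.2 = 0 then (ψ (v.1 - 1, 0) + ψ (v.1 - 1, 1)) / (Real.sqrt 2 : ℂ)
  else (ψ (v.1 + 1, 0) - ψ (v.1 + 1, 1)) / (Real.sqrt 2 : ℂ)

/-- The basis state `|x,n⟩`. -/
def ket (x : ℤ) (n : Fin 2) : QState := fun v => if v = (x, n) then 1 else 0

/-- Pure Hadamard-walk probabilities `W_{m,n}(x,t) = |⟨x,n|U^t|0,m⟩|²`. -/
def W (m n : Fin 2) (x : ℤ) (t : ℕ) : ℝ := ‖(hadamardStep^[t] (ket 0 m)) (x, n)‖ ^ 2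

/-- Measurement operators, indexed by `𝔸 = {c} ∪ ℤ×{1,2}`:
`none` is the coherent projection `A_c = √(1-p)·I`, and `some (x,n)` is the
decoherence projection `A_{x,n} = √p |x,n⟩⟨x,n|`. -/
def measOp (p : ℝ) : Option (ℤ × Fin 2) → QState → QState
  | none => fun ψ v => (Real.sqrt (1 - p) : ℂ) * ψ v
  | some w => fun ψ v => if v = w then (Real.sqrt p : ℂ) * ψ w else 0

/-- The amplitude `(A_{j_t}U)⋯(A_{j_1}U)|0,m⟩` along the path `j`. -/
def pathAmp (p : ℝ) (m : Fin 2) : (t : ℕ) → (Fin t → Option (ℤ × Fin 2)) → QState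
  | 0, _ => ket 0 m
  | t + 1, j => measOp p (j (Fin.last t)) (hadamardStep (pathAmp p m t fun i => j i.castSucc))

/-- Decoherent Hadamard-walk probabilities
`P_{m,n}(x,t) = Σ_{j∈𝔸^t} |⟨x,n|(A_{j_t}U)⋯(A_{j_1}U)|0,m⟩|²`. -/
def Pdec (p : ℝ) (m n : Fin 2) (x : ℤ) (t : ℕ) : ℝ :=
  ∑' j : Fin t → Option (ℤ × Fin 2), ‖pathAmp p m t j (x, n)‖ ^ 2

/-- `Ŵ_{m,n}(k,t) = Σ_x W_{m,n}(x,t) e^{ikx}`. -/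
def What (m n : Fin 2) (k : ℝ) (t : ℕ) : ℂ :=
  ∑' x : ℤ, (W m n x t : ℂ) * Complex.exp (Complex.I * k * x)

/-- `P̂_{m,n}(k,z) = Σ_{t≥0} Σ_x P_{m,n}(x,t) e^{ikx} z^t`. -/
def Phat (p : ℝ) (m n : Fin 2) (k : ℝ) (z : ℂ) : ℂ :=
  ∑' t : ℕ, (∑' x : ℤ, (Pdec p m n x t : ℂ) * Complex.exp (Complex.I * k * x)) * z ^ t

/-- `Q̂_{m,n}(k,z) = (p/q) Σ_{t≥1} Ŵ_{m,n}(k,t) (qz)^t = p Σ_{t≥1} Ŵ_{m,n}(k,t) q^{t-1} z^t`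
with `q = 1-p`. -/
def Qhat (p : ℝ) (m n : Fin 2) (k : ℝ) (z : ℂ) : ℂ :=
  (p : ℂ) * ∑' t : ℕ, What m n k (t + 1) * ((1 - p : ℝ) : ℂ) ^ t * z ^ (t + 1)

/-- The matrix `P(k,z) = (P̂_{m,n}(k,z))`. -/
def Pmat (p k : ℝ) (z : ℂ) : Matrix (Fin 2) (Fin 2) ℂ := Matrix.of fun m n => Phat p m n k z

/-- The matrix `Q(k,z) = (Q̂_{m,n}(k,z))`. -/
def Qmat (p k : ℝ) (z : ℂ) : Matrix (Fin 2) (Fin 2) ℂ := Matrix.of fun m n => Qhat p m n k z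

/-- Maximum row-sum norm of a 2×2 complex matrix. -/
def rowSumNorm (A : Matrix (Fin 2) (Fin 2) ℂ) : ℝ :=
  max (‖A 0 0‖ + ‖A 0 1‖) (‖A 1 0‖ + ‖A 1 1‖)

/-- Distribution of the symmetric decoherent Hadamard walk:
`P(X_t = x) = (1/2) Σ_{m,n} P_{m,n}(x,t)`. -/
def PsymProb (p : ℝ) (x : ℤ) (t : ℕ) : ℝ := (1/2) * ∑ m : Fin 2, ∑ n : Fin 2, Pdec p m n x t

/-- Mean position of the symmetric decoherent walk. -/
def symMean (p : ℝ) (t : ℕ) : ℝ := ∑' x : ℤ, (x : ℝ) * PsymProb p x t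

/-- Variance of the symmetric decoherent walk. -/
def symVar (p : ℝ) (t : ℕ) : ℝ :=
  (∑' x : ℤ, (x : ℝ) ^ 2 * PsymProb p x t) - (∑' x : ℤ, (x : ℝ) * PsymProb p x t) ^ 2

/-- The symmetric generating function `P̂(k,z) = (1/2) Σ_{m,n} P̂_{m,n}(k,z)`. -/
def PhatSym (p k : ℝ) (z : ℂ) : ℂ := (1/2) * ∑ m : Fin 2, ∑ n : Fin 2, Phat p m n k z

/-- Characteristic function `P̂(k,t)` of the symmetric decoherent walk. -/
def charSym (p k : ℝ) (t : ℕ) : ℂ :=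
  ∑' x : ℤ, (PsymProb p x t : ℂ) * Complex.exp (Complex.I * k * x)

/-- Distribution of the decoherent walk started at `|0,1⟩`: `P(X̃_t = x) = Σ_n P_{1,n}(x,t)`. -/
def Ptilde (p : ℝ) (x : ℤ) (t : ℕ) : ℝ := ∑ n : Fin 2, Pdec p 0 n x t

/-- Mean position of the decoherent walk started at `|0,1⟩`. -/
def tildeMean (p : ℝ) (t : ℕ) : ℝ := ∑' x : ℤ, (x : ℝ) * Ptilde p x t

/-- Variance of the decoherent walk started at `|0,1⟩`. -/
def tildeVar (p : ℝ) (t : ℕ) : ℝ :=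
  (∑' x : ℤ, (x : ℝ) ^ 2 * Ptilde p x t) - (∑' x : ℤ, (x : ℝ) * Ptilde p x t) ^ 2

/-- Characteristic function of the decoherent walk started at `|0,1⟩`. -/
def charTilde (p k : ℝ) (t : ℕ) : ℂ :=
  ∑' x : ℤ, (Ptilde p x t : ℂ) * Complex.exp (Complex.I * k * x)

/-- The symmetric initial state `φ₀ = (|0,1⟩ + i|0,2⟩)/√2`. -/
def phi0 : QState := fun v =>
  if v = ((0 : ℤ), (0 : Fin 2)) then (1 / Real.sqrt 2 : ℂ)
  else if v = ((0 : ℤ), (1 : Fin 2)) then Complex.I / Real.sqrt 2 else 0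

/-- Distribution of the pure symmetric Hadamard walk: `P(Q_t = x) = Σ_n |⟨x,n|U^t|φ₀⟩|²`. -/
def Ppure (x : ℤ) (t : ℕ) : ℝ := ∑ n : Fin 2, ‖(hadamardStep^[t] phi0) (x, n)‖ ^ 2

/-- Variance of the pure symmetric Hadamard walk. -/
def pureVar (t : ℕ) : ℝ :=
  (∑' x : ℤ, (x : ℝ) ^ 2 * Ppure x t) - (∑' x : ℤ, (x : ℝ) * Ppure x t) ^ 2

/-- `E(k,z) = √((q²z² − (1+cos k)qz + 1)(q²z² + (1+cos k)qz + 1))`, principal branch. -/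
def Efun (q k : ℝ) (z : ℂ) : ℂ :=
  (((q : ℂ) ^ 2 * z ^ 2 - (1 + (Real.cos k : ℂ)) * (q : ℂ) * z + 1) *
    ((q : ℂ) ^ 2 * z ^ 2 + (1 + (Real.cos k : ℂ)) * (q : ℂ) * z + 1)) ^ ((1 : ℂ) / 2)

/-! ### Linearity, translation invariance and unitarity of the walk -/

lemma hadamardStep_smul (c : ℂ) (ψ : QState) : hadamardStep (c • ψ) = c • hadamardStep ψ := by
  funext v
  simp only [hadamardStep, Pi.smul_apply, smul_eq_mul]
  split_ifs <;> ring

lemma iterate_hadamardStep_smul (r : ℕ) (c : ℂ) (ψ : QState) :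
    hadamardStep^[r] (c • ψ) = c • hadamardStep^[r] ψ :=
  Function.Commute.iterate_left (f := hadamardStep) (g := fun ψ => c • ψ)
    (hadamardStep_smul c) r ψ

lemma iterate_hadamardStep_ket (r : ℕ) (y : ℤ) (l : Fin 2) (x : ℤ) (n : Fin 2) :
    (hadamardStep^[r] (ket y l)) (x, n) = (hadamardStep^[r] (ket 0 l)) (x - y, n) := by
  induction r generalizing x n with
  | zero => simp [ket, sub_eq_zero]
  | succ r ih =>
    rw [Function.iterate_succ_apply', Function.iterate_succ_apply']
    simp only [hadamardStep, ih]
    rw [sub_right_comm x 1 y, sub_add_eq_add_sub x y 1]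

lemma tsum_prod_fin_two (f : ℤ × Fin 2 → ENNReal) :
    ∑' v, f v = ∑' x, f (x, 0) + ∑' x, f (x, 1) := by
  rw [ENNReal.tsum_prod', ← ENNReal.tsum_add]
  exact tsum_congr fun x => by simp [tsum_fintype]

lemma enorm_sq_eq_ofReal (a : ℂ) : ‖a‖ₑ ^ 2 = ENNReal.ofReal (‖a‖ ^ 2) := by
  rw [← ofReal_norm, ENNReal.ofReal_pow (norm_nonneg _)]

lemma enorm_hadamard_sq_add (a b : ℂ) :
    ‖(a + b) / (Real.sqrt 2 : ℂ)‖ₑ ^ 2 + ‖(a - b) / (Real.sqrt 2 : ℂ)‖ₑ ^ 2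
      = ‖a‖ₑ ^ 2 + ‖b‖ₑ ^ 2 := by
  simp only [enorm_sq_eq_ofReal]
  rw [← ENNReal.ofReal_add (by positivity) (by positivity),
    ← ENNReal.ofReal_add (by positivity) (by positivity)]
  have h := parallelogram_law_with_norm ℝ a b
  have h2 : Real.sqrt 2 ^ 2 = 2 := Real.sq_sqrt (by norm_num)
  congr 1
  rw [norm_div, norm_div, Complex.norm_real, Real.norm_of_nonneg (Real.sqrt_nonneg _),
    div_pow, div_pow, h2]
  linarith

lemma tsum_enorm_hadamardStep_sq (ψ : QState) :
    ∑' v, ‖hadamardStep ψ v‖ₑ ^ 2 = ∑' v, ‖ψ v‖ₑ ^ 2 := by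
  rw [tsum_prod_fin_two, tsum_prod_fin_two, ← ENNReal.tsum_add (f := fun x => ‖ψ (x, 0)‖ₑ ^ 2)]
  simp only [hadamardStep, if_true, one_ne_zero, if_false]
  have hsub := (Equiv.subRight (1 : ℤ)).tsum_eq
    fun x => ‖(ψ (x, 0) + ψ (x, 1)) / (Real.sqrt 2 : ℂ)‖ₑ ^ 2
  have hadd := (Equiv.addRight (1 : ℤ)).tsum_eq
    fun x => ‖(ψ (x, 0) - ψ (x, 1)) / (Real.sqrt 2 : ℂ)‖ₑ ^ 2
  simp only [Equiv.subRight_apply, Equiv.coe_addRight] at hsub hadd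
  rw [hsub, hadd, ← ENNReal.tsum_add]
  exact tsum_congr fun x => enorm_hadamard_sq_add _ _

lemma tsum_enorm_ket_sq (y : ℤ) (l : Fin 2) : ∑' v, ‖ket y l v‖ₑ ^ 2 = 1 := by
  rw [tsum_eq_single (y, l) fun v hv => by simp [ket, hv]]
  simp [ket]

/-! ### Summing over decoherence histories -/

/-- Probability of `|x,n⟩` after `s` decoherent steps followed by `r` coherent ones. -/
def mixedProb (p : ℝ) (m : Fin 2) (s r : ℕ) (n : Fin 2) (x : ℤ) : ENNReal :=
  ∑' j : Fin s → Option (ℤ × Fin 2), ‖(hadamardStep^[r] (pathAmp p m s j)) (x, n)‖ₑ ^ 2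

lemma mixedProb_zero_left (p : ℝ) (m : Fin 2) (r : ℕ) (n : Fin 2) (x : ℤ) :
    mixedProb p m 0 r n x = ‖(hadamardStep^[r] (ket 0 m)) (x, n)‖ₑ ^ 2 := by
  simp [mixedProb, pathAmp, tsum_fintype]

lemma measOp_none (p : ℝ) (ψ : QState) : measOp p none ψ = (Real.sqrt (1 - p) : ℂ) • ψ := rfl

lemma measOp_some (p : ℝ) (w : ℤ × Fin 2) (ψ : QState) :
    measOp p (some w) ψ = ((Real.sqrt p : ℂ) * ψ w) • ket w.1 w.2 := by
  funext v
  simp [measOp, ket]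

lemma enorm_sqrt_sq {a : ℝ} (ha : 0 ≤ a) : ‖(Real.sqrt a : ℂ)‖ₑ ^ 2 = ENNReal.ofReal a := by
  rw [enorm_sq_eq_ofReal, Complex.norm_real, Real.norm_of_nonneg (Real.sqrt_nonneg _),
    Real.sq_sqrt ha]

lemma tsum_option_ennreal {α : Type*} (f : Option α → ENNReal) :
    ∑' o, f o = f none + ∑' a, f (some a) := by
  rw [← (Equiv.optionEquivSumPUnit.{0} α).symm.tsum_eq f,
    ENNReal.summable.tsum_sum ENNReal.summable]
  simp [tsum_fintype, add_comm]

lemma mixedProb_succ_left {p : ℝ} (hp0 : 0 ≤ p) (hp1 : p ≤ 1) (m : Fin 2) (s r : ℕ) (n : Fin 2)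
    (x : ℤ) :
    mixedProb p m (s + 1) r n x = ENNReal.ofReal (1 - p) * mixedProb p m s (r + 1) n x +
      ENNReal.ofReal p * ∑' w : ℤ × Fin 2,
        mixedProb p m s 1 w.2 w.1 * ‖(hadamardStep^[r] (ket w.1 w.2)) (x, n)‖ₑ ^ 2 := by
  have key (j : Fin s → Option (ℤ × Fin 2)) :
      ∑' o, ‖(hadamardStep^[r] (measOp p o (hadamardStep (pathAmp p m s j)))) (x, n)‖ₑ ^ 2 =
        ENNReal.ofReal (1 - p) * ‖(hadamardStep^[r + 1] (pathAmp p m s j)) (x, n)‖ₑ ^ 2 +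
        ENNReal.ofReal p * ∑' w : ℤ × Fin 2, ‖hadamardStep (pathAmp p m s j) w‖ₑ ^ 2 *
          ‖(hadamardStep^[r] (ket w.1 w.2)) (x, n)‖ₑ ^ 2 := by
    rw [tsum_option_ennreal, ← ENNReal.tsum_mul_left]
    simp only [measOp_none, measOp_some, iterate_hadamardStep_smul, Pi.smul_apply, enorm_smul,
      enorm_mul, mul_pow, enorm_sqrt_sq hp0, enorm_sqrt_sq (sub_nonneg.2 hp1), mul_assoc,
      Function.iterate_succ_apply]
  unfold mixedProb
  rw [← (Fin.snocEquiv fun _ : Fin (s + 1) => Option (ℤ × Fin 2)).tsum_eq, ENNReal.tsum_prod',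
    ENNReal.tsum_comm]
  simp only [pathAmp, Fin.snocEquiv_apply, Fin.snoc_last, Fin.snoc_castSucc, key]
  rw [ENNReal.tsum_add, ENNReal.tsum_mul_left, ENNReal.tsum_mul_left, ENNReal.tsum_comm]
  simp only [← ENNReal.tsum_mul_right, Function.iterate_one]

lemma tsum_enorm_iterate_hadamardStep_sq (r : ℕ) (ψ : QState) :
    ∑' v, ‖(hadamardStep^[r] ψ) v‖ₑ ^ 2 = ∑' v, ‖ψ v‖ₑ ^ 2 := by
  induction r with
  | zero => rfl
  | succ r ih => rw [Function.iterate_succ_apply', tsum_enorm_hadamardStep_sq, ih]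

lemma tsum_mixedProb_eq (p : ℝ) (m : Fin 2) (s r : ℕ) :
    ∑' v : ℤ × Fin 2, mixedProb p m s r v.2 v.1 = ∑' v : ℤ × Fin 2, mixedProb p m s 0 v.2 v.1 := by
  unfold mixedProb
  rw [ENNReal.tsum_comm, ENNReal.tsum_comm (α := ℤ × Fin 2)]
  exact tsum_congr fun j => tsum_enorm_iterate_hadamardStep_sq r _

lemma tsum_mixedProb {p : ℝ} (hp0 : 0 ≤ p) (hp1 : p ≤ 1) (m : Fin 2) (s r : ℕ) :
    ∑' v : ℤ × Fin 2, mixedProb p m s r v.2 v.1 = 1 := by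
  rw [tsum_mixedProb_eq]
  induction s with
  | zero => simpa only [mixedProb_zero_left, Function.iterate_zero, id_eq, Prod.mk.eta] using tsum_enorm_ket_sq 0 m
  | succ s ih =>
    simp only [mixedProb_succ_left hp0 hp1]
    rw [ENNReal.tsum_add, ENNReal.tsum_mul_left, ENNReal.tsum_mul_left, ENNReal.tsum_comm]
    simp only [ENNReal.tsum_mul_left, Function.iterate_zero, id_eq, Prod.mk.eta,
      tsum_enorm_ket_sq, mul_one]
    rw [tsum_mixedProb_eq, ih, mul_one, mul_one,
      ← ENNReal.ofReal_add (sub_nonneg.2 hp1) hp0, sub_add_cancel, ENNReal.ofReal_one]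

lemma tsum_mixedProb_le_one {p : ℝ} (hp0 : 0 ≤ p) (hp1 : p ≤ 1) (m : Fin 2) (s r : ℕ)
    (n : Fin 2) : ∑' x, mixedProb p m s r n x ≤ 1 := by
  rw [← tsum_mixedProb hp0 hp1 m s r, tsum_prod_fin_two]
  fin_cases n
  · exact le_self_add
  · exact le_add_self

lemma tsum_mixedProb_ne_top {p : ℝ} (hp0 : 0 ≤ p) (hp1 : p ≤ 1) (m : Fin 2) (s r : ℕ)
    (n : Fin 2) : ∑' x, mixedProb p m s r n x ≠ ⊤ :=
  ((tsum_mixedProb_le_one hp0 hp1 m s r n).trans_lt ENNReal.one_lt_top).ne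

lemma toReal_mixedProb_zero_right (p : ℝ) (m : Fin 2) (s : ℕ) (n : Fin 2) (x : ℤ) :
    (mixedProb p m s 0 n x).toReal = Pdec p m n x s := by
  unfold mixedProb Pdec
  rw [ENNReal.tsum_toReal_eq fun j => by simp]
  simp

lemma toReal_mixedProb_zero_left (p : ℝ) (m : Fin 2) (r : ℕ) (n : Fin 2) (x : ℤ) :
    (mixedProb p m 0 r n x).toReal = W m n x r := by
  simp [mixedProb_zero_left, W]

lemma mixedProb_succ_left_eq_conv {p : ℝ} (hp0 : 0 ≤ p) (hp1 : p ≤ 1) (m : Fin 2) (s r : ℕ)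
    (n : Fin 2) (x : ℤ) :
    mixedProb p m (s + 1) r n x = ENNReal.ofReal (1 - p) * mixedProb p m s (r + 1) n x +
      ENNReal.ofReal p *
        ((∑' y, mixedProb p m s 1 0 y * mixedProb p 0 0 r n (x - y)) +
          ∑' y, mixedProb p m s 1 1 y * mixedProb p 1 0 r n (x - y)) := by
  rw [mixedProb_succ_left hp0 hp1, tsum_prod_fin_two]
  simp only [mixedProb_zero_left, iterate_hadamardStep_ket r _ _ x n]

lemma mixedProb_succ_zero {p : ℝ} (hp0 : 0 ≤ p) (hp1 : p ≤ 1) (m : Fin 2) (s : ℕ)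
    (n : Fin 2) (x : ℤ) : mixedProb p m (s + 1) 0 n x = mixedProb p m s 1 n x := by
  rw [mixedProb_succ_left hp0 hp1, tsum_eq_single (x, n)]
  · simp only [Function.iterate_zero, id_eq, ket, if_true, enorm_one, one_pow, mul_one]
    rw [← add_mul, ← ENNReal.ofReal_add (sub_nonneg.2 hp1) hp0, sub_add_cancel,
      ENNReal.ofReal_one, one_mul]
  · rintro ⟨y, l⟩ h
    simp [ket, h.symm]

/-! ### Fourier series of summable weights on `ℤ` -/

/-- The Fourier series `Σ_x f(x) e^{ikx}` of a weight on `ℤ`. -/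
def weightFourier (k : ℝ) (f : ℤ → ENNReal) : ℂ :=
  ∑' x : ℤ, ((f x).toReal : ℂ) * Complex.exp (Complex.I * k * x)

lemma norm_toReal_mul_exp (k : ℝ) (a : ENNReal) (x : ℤ) :
    ‖(a.toReal : ℂ) * Complex.exp (Complex.I * k * x)‖ = a.toReal := by
  have h : Complex.I * k * x = ((k * x : ℝ) : ℂ) * Complex.I := by push_cast; ring
  rw [norm_mul, h, Complex.norm_exp_ofReal_mul_I, mul_one, Complex.norm_real,
    Real.norm_of_nonneg ENNReal.toReal_nonneg]

lemma summable_norm_weightFourier (k : ℝ) {f : ℤ → ENNReal} (hf : ∑' x, f x ≠ ⊤) :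
    Summable fun x : ℤ => ‖((f x).toReal : ℂ) * Complex.exp (Complex.I * k * x)‖ := by
  simpa only [norm_toReal_mul_exp] using ENNReal.summable_toReal hf

lemma norm_weightFourier_le_one (k : ℝ) {f : ℤ → ENNReal} (hf : ∑' x, f x ≤ 1) :
    ‖weightFourier k f‖ ≤ 1 := by
  have hf' : ∑' x, f x ≠ ⊤ := (hf.trans_lt ENNReal.one_lt_top).ne
  refine (norm_tsum_le_tsum_norm (summable_norm_weightFourier k hf')).trans ?_
  simp only [norm_toReal_mul_exp]
  rw [← ENNReal.tsum_toReal_eq (ENNReal.ne_top_of_tsum_ne_top hf')]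
  exact ENNReal.toReal_le_of_le_ofReal zero_le_one (by simpa using hf)

lemma weightFourier_add (k : ℝ) {f g : ℤ → ENNReal} (hf : ∑' x, f x ≠ ⊤) (hg : ∑' x, g x ≠ ⊤) :
    weightFourier k (fun x => f x + g x) = weightFourier k f + weightFourier k g := by
  unfold weightFourier
  rw [← (summable_norm_weightFourier k hf).of_norm.tsum_add
    (summable_norm_weightFourier k hg).of_norm]
  refine tsum_congr fun x => ?_
  rw [ENNReal.toReal_add (ENNReal.ne_top_of_tsum_ne_top hf x)
    (ENNReal.ne_top_of_tsum_ne_top hg x), Complex.ofReal_add, add_mul]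

lemma weightFourier_ofReal_mul (k : ℝ) {c : ℝ} (hc : 0 ≤ c) (f : ℤ → ENNReal) :
    weightFourier k (fun x => ENNReal.ofReal c * f x) = c * weightFourier k f := by
  unfold weightFourier
  rw [← tsum_mul_left]
  exact tsum_congr fun x => by
    rw [ENNReal.toReal_mul, ENNReal.toReal_ofReal hc, Complex.ofReal_mul, mul_assoc]

lemma tsum_conv (f g : ℤ → ENNReal) :
    ∑' x, ∑' y, f y * g (x - y) = (∑' x, f x) * ∑' x, g x := by
  rw [ENNReal.tsum_comm, ← ENNReal.tsum_mul_right]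
  refine tsum_congr fun y => ?_
  rw [ENNReal.tsum_mul_left]
  exact congrArg (f y * ·) ((Equiv.subRight y).tsum_eq g)

lemma tsum_conv_ne_top {f g : ℤ → ENNReal} (hf : ∑' x, f x ≠ ⊤) (hg : ∑' x, g x ≠ ⊤) :
    ∑' x, ∑' y, f y * g (x - y) ≠ ⊤ := by
  rw [tsum_conv]
  exact ENNReal.mul_ne_top hf hg

lemma weightFourier_conv (k : ℝ) {f g : ℤ → ENNReal} (hf : ∑' x, f x ≠ ⊤)
    (hg : ∑' x, g x ≠ ⊤) :
    weightFourier k (fun x => ∑' y, f y * g (x - y)) = weightFourier k f * weightFourier k g := by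
  have hf' := summable_norm_weightFourier k hf
  have hg' := summable_norm_weightFourier k hg
  let e : ℤ × ℤ ≃ ℤ × ℤ :=
    { toFun := fun v => (v.2, v.1 - v.2)
      invFun := fun v => (v.1 + v.2, v.1)
      left_inv := fun v => by simp
      right_inv := fun v => by simp }
  have hs := e.summable_iff.2 (summable_mul_of_summable_norm hf' hg')
  unfold weightFourier
  rw [tsum_mul_tsum_of_summable_norm hf' hg', ← e.tsum_eq]
  refine Eq.trans ?_ (Summable.tsum_prod hs).symm
  refine tsum_congr fun x => ?_
  rw [ENNReal.tsum_toReal_eq fun y => ENNReal.mul_ne_top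
    (ENNReal.ne_top_of_tsum_ne_top hf y) (ENNReal.ne_top_of_tsum_ne_top hg _),
    Complex.ofReal_tsum, ← tsum_mul_right]
  refine tsum_congr fun y => ?_
  have h : Complex.exp (Complex.I * k * x) =
      Complex.exp (Complex.I * k * y) * Complex.exp (Complex.I * k * ((x - y : ℤ) : ℂ)) := by
    rw [← Complex.exp_add]
    push_cast
    ring_nf
  simp only [e, Equiv.coe_fn_mk, Function.comp_apply, ENNReal.toReal_mul, Complex.ofReal_mul, h]
  ring

/-! ### The renewal recursion -/

lemma weightFourier_mixedProb_zero_left (k p : ℝ) (m : Fin 2) (r : ℕ) (n : Fin 2) :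
    weightFourier k (mixedProb p m 0 r n) = What m n k r := by
  simp only [weightFourier, What, toReal_mixedProb_zero_left]

lemma weightFourier_mixedProb_zero_zero (k p : ℝ) (m n : Fin 2) :
    weightFourier k (mixedProb p m 0 0 n) = if m = n then 1 else 0 := by
  rw [weightFourier, tsum_eq_single 0]
  · rw [toReal_mixedProb_zero_left]
    by_cases h : m = n <;> simp [W, ket, h, eq_comm]
  · intro x hx
    simp [toReal_mixedProb_zero_left, W, ket, hx]

lemma weightFourier_mixedProb_succ {p : ℝ} (k : ℝ) (hp0 : 0 ≤ p) (hp1 : p ≤ 1) (m : Fin 2)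
    (s r : ℕ) (n : Fin 2) :
    weightFourier k (mixedProb p m (s + 1) r n) =
      (1 - p : ℝ) * weightFourier k (mixedProb p m s (r + 1) n) +
      p * ∑ l, weightFourier k (mixedProb p m (s + 1) 0 l) * What l n k r := by
  have hne := fun m s r n => tsum_mixedProb_ne_top hp0 hp1 m s r n
  have hconv := fun l => tsum_conv_ne_top (hne m s 1 l) (hne l 0 r n)
  rw [funext (mixedProb_succ_left_eq_conv hp0 hp1 m s r n), weightFourier_add,
    weightFourier_ofReal_mul k (sub_nonneg.2 hp1), weightFourier_ofReal_mul k hp0,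
    weightFourier_add k (hconv 0) (hconv 1), weightFourier_conv k (hne m s 1 0) (hne 0 0 r n),
    weightFourier_conv k (hne m s 1 1) (hne 1 0 r n), Fin.sum_univ_two]
  · simp only [weightFourier_mixedProb_zero_left, funext (mixedProb_succ_zero hp0 hp1 m s _)]
  · rw [ENNReal.tsum_mul_left]
    exact ENNReal.mul_ne_top ENNReal.ofReal_ne_top (hne _ _ _ _)
  · rw [ENNReal.tsum_mul_left, ENNReal.tsum_add]
    exact ENNReal.mul_ne_top ENNReal.ofReal_ne_top (ENNReal.add_ne_top.2 ⟨hconv 0, hconv 1⟩)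

lemma weightFourier_mixedProb_renewal {p : ℝ} (k : ℝ) (hp0 : 0 ≤ p) (hp1 : p ≤ 1) (m : Fin 2)
    (s r : ℕ) (n : Fin 2) :
    weightFourier k (mixedProb p m s (r + 1) n) =
      ((1 - p : ℝ) : ℂ) ^ (s + 1) * What m n k (s + r + 1) +
      ∑ v ∈ Finset.HasAntidiagonal.antidiagonal s, ∑ l, weightFourier k (mixedProb p m v.1 0 l) *
        (p * ((1 - p : ℝ) : ℂ) ^ v.2 * What l n k (v.2 + r + 1)) := by
  induction s generalizing r with
  | zero =>
    simp only [weightFourier_mixedProb_zero_left, Finset.Nat.antidiagonal_zero,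
      Finset.sum_singleton]
    simp only [← weightFourier_mixedProb_zero_left k p m 0, weightFourier_mixedProb_zero_zero,
      ite_mul, one_mul, zero_mul, Finset.sum_ite_eq, Finset.mem_univ, if_true]
    push_cast
    ring_nf
  | succ s ih =>
    have e1 : s + (r + 1) + 1 = s + 1 + r + 1 := by ring
    have e2 (i : ℕ) : i + (r + 1) + 1 = i + 1 + r + 1 := by ring
    rw [weightFourier_mixedProb_succ k hp0 hp1, ih (r + 1), Finset.Nat.sum_antidiagonal_succ',
      mul_add, add_assoc, e1, ← mul_assoc, ← pow_succ', add_comm (_ * ∑ v ∈ _, _)]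
    simp only [e2, Finset.mul_sum, pow_succ', pow_zero, mul_one, zero_add]
    congr 2
    · exact Finset.sum_congr rfl fun l _ => by ring
    · exact Finset.sum_congr rfl fun v _ => Finset.sum_congr rfl fun l _ => by ring

/-! ### Generating functions -/

lemma summable_norm_mul_pow {a : ℕ → ℂ} (ha : ∀ t, ‖a t‖ ≤ 1) {z : ℂ} (hz : ‖z‖ < 1) :
    Summable fun t => ‖a t * z ^ t‖ := by
  refine (summable_geometric_of_lt_one (norm_nonneg z) hz).of_nonneg_of_le
    (fun t => norm_nonneg _) fun t => ?_
  rw [norm_mul, norm_pow]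
  exact mul_le_of_le_one_left (by positivity) (ha t)

lemma Phat_eq_tsum (p : ℝ) (m n : Fin 2) (k : ℝ) (z : ℂ) :
    Phat p m n k z = ∑' t : ℕ, weightFourier k (mixedProb p m t 0 n) * z ^ t := by
  simp only [Phat, weightFourier, toReal_mixedProb_zero_right]

lemma norm_weightFourier_mixedProb_le_one {p : ℝ} (k : ℝ) (hp0 : 0 ≤ p) (hp1 : p ≤ 1)
    (m : Fin 2) (s r : ℕ) (n : Fin 2) : ‖weightFourier k (mixedProb p m s r n)‖ ≤ 1 :=
  norm_weightFourier_le_one k (tsum_mixedProb_le_one hp0 hp1 m s r n)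

lemma summable_norm_Phat {p : ℝ} (k : ℝ) (hp0 : 0 ≤ p) (hp1 : p ≤ 1) (m n : Fin 2)
    {z : ℂ} (hz : ‖z‖ < 1) :
    Summable fun t : ℕ => ‖weightFourier k (mixedProb p m t 0 n) * z ^ t‖ :=
  summable_norm_mul_pow (fun t => norm_weightFourier_mixedProb_le_one k hp0 hp1 m t 0 n) hz

lemma summable_norm_Qhat {p : ℝ} (k : ℝ) (hp0 : 0 ≤ p) (hp1 : p ≤ 1) (m n : Fin 2)
    {z : ℂ} (hz : ‖z‖ < 1) :
    Summable fun t : ℕ => ‖What m n k (t + 1) * ((1 - p : ℝ) : ℂ) ^ t * z ^ (t + 1)‖ := by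
  have h : Summable fun t : ℕ =>
      ‖What m n k (t + 1) * ((1 - p : ℝ) : ℂ) ^ t * z ^ t‖ * ‖z‖ := by
    refine (summable_norm_mul_pow (fun t => ?_) hz).mul_right _
    rw [norm_mul, norm_pow, Complex.norm_real, Real.norm_of_nonneg (sub_nonneg.2 hp1),
      ← weightFourier_mixedProb_zero_left k p]
    exact mul_le_one₀ (norm_weightFourier_mixedProb_le_one k hp0 hp1 _ _ _ _)
      (by have := sub_nonneg.2 hp1; positivity) (pow_le_one₀ (sub_nonneg.2 hp1) (by linarith))
  refine h.congr fun t => ?_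
  rw [← norm_mul, pow_succ, mul_assoc _ _ z]

lemma Phat_mul_Qhat {p : ℝ} (k : ℝ) (hp0 : 0 ≤ p) (hp1 : p ≤ 1) (m l n : Fin 2)
    {z : ℂ} (hz : ‖z‖ < 1) :
    HasSum (fun t => ∑ v ∈ Finset.HasAntidiagonal.antidiagonal t,
        weightFourier k (mixedProb p m v.1 0 l) * z ^ v.1 *
          (p * (What l n k (v.2 + 1) * ((1 - p : ℝ) : ℂ) ^ v.2 * z ^ (v.2 + 1))))
      (Phat p m l k z * Qhat p l n k z) := by
  have hP := summable_norm_Phat k hp0 hp1 m l hz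
  have hQ : Summable fun t : ℕ =>
      ‖(p : ℂ) * (What l n k (t + 1) * ((1 - p : ℝ) : ℂ) ^ t * z ^ (t + 1))‖ := by
    simpa only [norm_mul (p : ℂ)] using (summable_norm_Qhat k hp0 hp1 l n hz).mul_left ‖(p : ℂ)‖
  rw [Phat_eq_tsum, Qhat, ← tsum_mul_left,
    tsum_mul_tsum_eq_tsum_sum_antidiagonal_of_summable_norm hP hQ]
  exact (summable_norm_sum_mul_antidiagonal_of_summable_norm hP hQ).of_norm.hasSum

lemma Phat_renewal {p : ℝ} (k : ℝ) (hp0 : 0 < p) (hp1 : p ≤ 1) {z : ℂ} (hz : ‖z‖ < 1)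
    (m n : Fin 2) :
    Phat p m n k z = (if m = n then 1 else 0) + (((1 - p) / p : ℝ) : ℂ) * Qhat p m n k z
      + ∑ l : Fin 2, Phat p m l k z * Qhat p l n k z := by
  rw [Phat_eq_tsum, (summable_norm_Phat k hp0.le hp1 m n hz).of_norm.tsum_eq_zero_add,
    weightFourier_mixedProb_zero_zero, pow_zero, mul_one, add_assoc]
  congr 1
  have hQ := ((summable_norm_Qhat k hp0.le hp1 m n hz).of_norm.hasSum.mul_left (p : ℂ)).mul_left
    (((1 - p) / p : ℝ) : ℂ)
  have hPQ := hasSum_sum (s := Finset.univ) fun l (_ : l ∈ Finset.univ) =>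
    Phat_mul_Qhat k hp0.le hp1 m l n hz
  refine Eq.trans (tsum_congr fun t => ?_) (hQ.add hPQ).tsum_eq
  rw [funext (mixedProb_succ_zero hp0.le hp1 m t n),
    weightFourier_mixedProb_renewal k hp0.le hp1, add_mul, Finset.sum_comm, Finset.sum_mul]
  congr 1
  · have hp : (p : ℂ) ≠ 0 := by exact_mod_cast hp0.ne'
    push_cast
    field_simp
    simp [pow_succ]
    ring
  · refine Finset.sum_congr rfl fun l _ => ?_
    rw [Finset.sum_mul]
    refine Finset.sum_congr rfl fun v hv => ?_
    rw [← Finset.HasAntidiagonal.mem_antidiagonal.1 hv]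
    ring

/-- The recursion for the Fourier-transformed generating functions:
`P̂_{m,n} = δ_{m,n} + (q/p)·Q̂_{m,n} + Σ_l P̂_{m,l}·Q̂_{l,n}`; in matrix form
`P = I + (q/p)Q + PQ`. -/
theorem phat_matrix_recursion (k p q : ℝ) (hp0 : 0 < p) (hp1 : p ≤ 1) (hq : q = 1 - p)
    (z : ℂ) (hz : ‖z‖ < 1) :
    (∀ m n : Fin 2, Phat p m n k z =
      (if m = n then 1 else 0) + ((q / p : ℝ) : ℂ) * Qhat p m n k z
        + ∑ l : Fin 2, Phat p m l k z * Qhat p l n k z) ∧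
    Pmat p k z = 1 + ((q / p : ℝ) : ℂ) • Qmat p k z + Pmat p k z * Qmat p k z := by
  subst hq
  refine ⟨Phat_renewal k hp0 hp1 hz, ?_⟩
  ext m n
  simpa only [Pmat, Qmat, Matrix.add_apply, Matrix.smul_apply, Matrix.mul_apply, Matrix.one_apply,
    Matrix.of_apply, smul_eq_mul] using Phat_renewal k hp0 hp1 hz m n

end
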